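/- A plane graph is a finite simple connected graph together with a (non-crossing) topological embedding in the plane; its angles are the pairs of consecutive edges in the vertex rotations of the embedding (equivalently, the vertex-face incidences along the face contours). A combinatorial pseudo-triangulation (CPT) is a plane graph each of whose angles is labelled "big" or "small" in such a way that every bounded face has exactly three small angles, all angles in the unbounded face are big, and no vertex is incident to more than one big angle. A vertex is pointed if it is incident to a big angle. A CPT has the generalized Laman property if every subset of $x$ non-pointed plus $y$ pointed vertices with $x+y\ge 2$ induces a subgraph with at most $3x+2y-3$ edges. Let $G$ be a combinatorial pseudo-triangulation on at least three vertices with the generalized Laman property. Then the faces of $G$ are non-degenerate, i.e., the edges incident to every face of $G$ (bounded or unbounded) form a simple closed cycle, and no edge appears twice in the contour cycle of any face. -/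

import Mathlib

/-! ## Plane graphs via rotation systems -/

universe u

/-- The permutation of the darts (oriented edges) of a simple graph reversing each dart. -/
def dartSymmPerm {V : Type u} (G : SimpleGraph V) : Equiv.Perm G.Dart where
  toFun := SimpleGraph.Dart.symm
  invFun := SimpleGraph.Dart.symm
  left_inv d := SimpleGraph.Dart.symm_symm d
  right_inv d := SimpleGraph.Dart.symm_symm d

/-- The setoid on `α` whose classes are the cycles (orbits) of a permutation `σ`. -/
def faceSetoid {α : Type u} (σ : Equiv.Perm α) : Setoid α :=
  ⟨σ.SameCycle, ⟨fun x => Equiv.Perm.SameCycle.refl σ x,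
    fun h => h.symm, fun h h' => h.trans h'⟩⟩

/-- A (topological, non-crossing) embedding of a connected finite graph `G` in the plane, encoded
combinatorially: a rotation system (`rot` is the counterclockwise cyclic order of the darts
leaving each vertex) which is planar, i.e. satisfies Euler's formula `v + f = e + 2`, together
with a distinguished outer (unbounded) face.  The faces are the orbits of the face permutation
`rot * symm`, which sends a dart to the next dart on the contour of the face alongside it. -/
structure PlaneEmb {V : Type u} (G : SimpleGraph V) where
  rot : Equiv.Perm G.Dart
  rot_fst : ∀ d : G.Dart, (rot d).fst = d.fst
  rot_vertex : ∀ d d' : G.Dart, d.fst = d'.fst → ∃ n : ℕ, (rot ^ n) d = d'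
  connected : G.Connected
  outer : Quotient (faceSetoid (rot * dartSymmPerm G))
  euler : Nat.card V + Nat.card (Quotient (faceSetoid (rot * dartSymmPerm G)))
      = Nat.card G.edgeSet + 2

namespace PlaneEmb

/-- The faces of a plane graph: orbits of the face permutation. -/
abbrev Face {V : Type u} {G : SimpleGraph V} (E : PlaneEmb G) : Type u :=
  Quotient (faceSetoid (E.rot * dartSymmPerm G))

/-- The face having the dart `d` on its contour. -/
def dartFace {V : Type u} {G : SimpleGraph V} (E : PlaneEmb G) (d : G.Dart) : E.Face :=
  Quotient.mk (faceSetoid (E.rot * dartSymmPerm G)) d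

/-- Each dart `d` determines an *angle* of the plane graph, namely the angle at the vertex
`d.fst` between the consecutive edges of `d` and `rot d`; `E.angleFace d` is the face this angle
lies in: the contour of that face arrives at `d.fst` along `d.symm` and leaves along `rot d`. -/
def angleFace {V : Type u} {G : SimpleGraph V} (E : PlaneEmb G) (d : G.Dart) : E.Face :=
  E.dartFace d.symm

end PlaneEmb

/-! ## Combinatorial pseudo-triangulations -/

/-- A vertex is *pointed* (w.r.t. an assignment `big` of which angles are labelled big)
if some angle at it is labelled big. -/
def PointedVx {V : Type u} {G : SimpleGraph V} (big : G.Dart → Prop) (v : V) : Prop :=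
  ∃ d : G.Dart, big d ∧ d.fst = v

/-- A *combinatorial pseudo-triangulation labelling* (CPT-labelling): every bounded face has
exactly three small angles, all angles of the unbounded face are big, and no vertex is
incident to more than one big angle. -/
structure IsCPTLabelling {V : Type u} {G : SimpleGraph V} (E : PlaneEmb G)
    (big : G.Dart → Prop) : Prop where
  bounded_small : ∀ F : E.Face, F ≠ E.outer →
    Nat.card {d : G.Dart | E.angleFace d = F ∧ ¬ big d} = 3
  outer_big : ∀ d : G.Dart, E.angleFace d = E.outer → big d
  one_big : ∀ d d' : G.Dart, big d → big d' → d.fst = d'.fst → d = d'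

/-- The generalized Laman property of a combinatorial pseudo-triangulation: any `x` non-pointed
plus `y` pointed vertices, with `x + y ≥ 2`, induce at most `3x + 2y - 3` edges. -/
def GenLaman {V : Type u} (G : SimpleGraph V) (big : G.Dart → Prop) : Prop :=
  ∀ S : Set V, 2 ≤ Nat.card S →
    (Nat.card ((G.induce S).edgeSet) : ℤ) ≤
      3 * Nat.card {v ∈ S | ¬ PointedVx big v} + 2 * Nat.card {v ∈ S | PointedVx big v} - 3

/-- A plane graph has *non-degenerate faces* if for every face (bounded or not) the edges incident
to the face are exactly the edges of a simple closed cycle of `G`, and no edge appears twice in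
the contour cycle of the face (i.e. no face lies on both sides of an edge). -/
def NonDegenerateFaces {V : Type u} {G : SimpleGraph V} (E : PlaneEmb G) : Prop :=
  ∀ F : E.Face,
    (∃ (v : V) (c : G.Walk v v), c.IsCycle ∧
      ∀ e : Sym2 V, e ∈ c.edges ↔ ∃ d : G.Dart, E.dartFace d = F ∧ d.edge = e) ∧
    ∀ d : G.Dart, E.dartFace d = F → E.dartFace d.symm ≠ F

/-- Euler's inequality for connected maps on surfaces, where `t` and `f` send a dart to its origin
and to its face, up to merging of vertices and faces. -/
theorem card_add_card_le_of_dart_maps {D X Y : Type*} [Finite D] [Finite X] [Finite Y]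
    (α : D → D) (hα : Function.Involutive α) (hα' : ∀ d, α d ≠ d) (φ : Equiv.Perm D)
    (t : D → X) (f : D → Y) (ht : Function.Surjective t) (hf : Function.Surjective f)
    (htφ : ∀ d, t (φ d) = t (α d)) (hfφ : ∀ d, f (φ d) = f d)
    (hconn : ∀ k : D → ℚ, (∀ d, k (α d) = k d) → (∀ d, k (φ d) = k d) → ∀ a b, k a = k b) :
    2 * (Nat.card X + Nat.card Y) ≤ Nat.card D + 4 := by
  classical
  have := Fintype.ofFinite D
  have := Fintype.ofFinite X
  have := Fintype.ofFinite Y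
  rcases isEmpty_or_nonempty D with hD | ⟨⟨d₀⟩⟩
  · have : IsEmpty X := ⟨fun x => hD.elim (ht x).choose⟩
    have : IsEmpty Y := ⟨fun x => hD.elim (hf x).choose⟩
    simp
  obtain ⟨lo, -⟩ : ∃ lo : LinearOrder D, True :=
    ⟨LinearOrder.lift' (Fintype.equivFin D) (Fintype.equivFin D).injective, trivial⟩
  let H := {d : D // d < α d}
  let δ (g : X → ℚ) (d : D) : ℚ := g (t (α d)) - g (t d)
  let ε (h : Y → ℚ) (d : D) : ℚ := h (f (α d)) - h (f d)
  have horth : ∀ g h, ∑ d, δ g d * ε h d = 0 := by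
    intro g h
    have h1 : ∑ d, δ g d * h (f d) = 0 := by
      have := Equiv.sum_comp φ (fun d => g (t d) * h (f d))
      simp only [htφ, hfφ] at this
      simp only [δ, sub_mul, Finset.sum_sub_distrib, this, sub_self]
    have h2 : ∑ d, δ g d * h (f (α d)) = 0 := by
      have := Equiv.sum_comp hα.toPerm (fun d => δ g d * h (f (α d)))
      rw [← this]
      simp only [Function.Involutive.coe_toPerm, hα _]
      rw [← neg_eq_zero, ← Finset.sum_neg_distrib, ← h1]
      refine Finset.sum_congr rfl fun d _ => ?_
      simp only [δ, hα _]
      ring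
    simp only [ε, mul_sub, Finset.sum_sub_distrib, h1, h2, sub_self]
  let L : ((X → ℚ) × (Y → ℚ)) →ₗ[ℚ] ((H → ℚ) × ℚ × ℚ) :=
    { toFun := fun p => (fun d => δ p.1 d + ε p.2 d, p.1 (t d₀), p.2 (f d₀))
      map_add' := by
        intro p q
        ext <;> simp [δ, ε]; ring
      map_smul' := by
        intro c p
        ext <;> simp [δ, ε]; ring }
  have hL : Function.Injective L := by
    rw [← LinearMap.ker_eq_bot, LinearMap.ker_eq_bot']
    rintro ⟨g, h⟩ hgh
    have e1 : ∀ d : H, δ g d + ε h d = 0 := fun d => congrFun (congrArg Prod.fst hgh) d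
    have e2 : g (t d₀) = 0 := congrArg (fun p => p.2.1) hgh
    have e3 : h (f d₀) = 0 := congrArg (fun p => p.2.2) hgh
    have e4 : ∀ d, δ g d + ε h d = 0 := by
      intro d
      rcases lt_or_gt_of_ne (hα' d) with hd | hd
      · have := e1 ⟨α d, by rwa [hα d]⟩
        simp only [δ, ε, hα _] at this ⊢
        linarith
      · exact e1 ⟨d, hd⟩
    have e5 : ∑ d, δ g d * δ g d = 0 := by
      rw [← neg_eq_zero, ← Finset.sum_neg_distrib, ← horth g h]
      refine Finset.sum_congr rfl fun d _ => ?_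
      rw [eq_neg_of_add_eq_zero_right (e4 d)]
      ring
    have e6 : ∀ d, δ g d = 0 := by
      intro d
      have := (Finset.sum_eq_zero_iff_of_nonneg (fun d _ => mul_self_nonneg (δ g d))).1 e5 d
        (Finset.mem_univ d)
      exact mul_self_eq_zero.1 this
    have e7 : ∀ d, ε h d = 0 := fun d => by simpa [e6 d] using e4 d
    have hg : ∀ d, g (t (α d)) = g (t d) := fun d => sub_eq_zero.1 (e6 d)
    have hh : ∀ d, h (f (α d)) = h (f d) := fun d => sub_eq_zero.1 (e7 d)
    have g0 : g = 0 := by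
      ext x
      obtain ⟨d, rfl⟩ := ht x
      rw [hconn (fun d => g (t d)) hg (fun d => by rw [htφ, hg]) d d₀, e2]
      rfl
    have h0 : h = 0 := by
      ext x
      obtain ⟨d, rfl⟩ := hf x
      rw [hconn (fun d => h (f d)) hh (fun d => by rw [hfφ]) d d₀, e3]
      rfl
    rw [g0, h0]
    rfl
  have hrank := LinearMap.finrank_le_finrank_of_injective hL
  simp only [Module.finrank_prod, Module.finrank_fintype_fun_eq_card, Module.finrank_self] at hrank
  have hH : Fintype.card H + Fintype.card H ≤ Fintype.card D := by
    rw [← Fintype.card_sum]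
    refine Fintype.card_le_of_injective (Sum.elim (fun d => d.1) (fun d => α d.1)) ?_
    refine Subtype.val_injective.sumElim (hα.injective.comp Subtype.val_injective) ?_
    rintro ⟨a, ha⟩ ⟨b, hb⟩ hab
    simp only at hab
    rw [hab, hα b] at ha
    exact lt_asymm ha hb
  simp only [Nat.card_eq_fintype_card]
  omega

/-- Multiplying a permutation by the transposition of two points of one cycle splits the cycle. -/
theorem exists_invariant_set_mul_swap {D : Type*} [Finite D] [DecidableEq D] (σ : Equiv.Perm D)
    {a b : D} (hab : a ≠ b) (h : σ.SameCycle a b) :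
    ∃ Q : Set D, (∀ x, (σ * Equiv.swap a b) x ∈ Q ↔ x ∈ Q) ∧ b ∈ Q ∧ a ∉ Q ∧
      ∀ x ∈ Q, σ.SameCycle a x := by
  classical
  have hex : ∃ n : ℕ, (σ ^ n) a = b := by
    obtain ⟨i, -, hi⟩ := h.exists_pow_eq'
    exact ⟨i, hi⟩
  let k := Nat.find hex
  have hk : (σ ^ k) a = b := Nat.find_spec hex
  have hmin : ∀ m < k, (σ ^ m) a ≠ b := fun m hm => Nat.find_min hex hm
  have hk0 : 0 < k := by
    rcases Nat.eq_zero_or_pos k with h0 | h0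
    · rw [h0] at hk
      exact absurd hk hab
    · exact h0
  have hnea : ∀ i, 0 < i → i ≤ k → (σ ^ i) a ≠ a := by
    intro i hi hik hia
    apply hmin (k - i) (by omega)
    have : (σ ^ (k - i)) ((σ ^ i) a) = b := by
      rw [← Equiv.Perm.mul_apply, ← pow_add, Nat.sub_add_cancel hik, hk]
    rwa [hia] at this
  let Q : Set D := {x | ∃ i, 0 < i ∧ i ≤ k ∧ (σ ^ i) a = x}
  have hfwd : Set.MapsTo (σ * Equiv.swap a b) Q Q := by
    rintro _ ⟨i, hi, hik, rfl⟩
    rcases hik.eq_or_lt with rfl | hlt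
    · exact ⟨1, one_pos, hk0, by rw [hk]; simp⟩
    · refine ⟨i + 1, by omega, hlt, ?_⟩
      rw [Equiv.Perm.mul_apply, Equiv.swap_apply_of_ne_of_ne (hnea i hi hik) (hmin i hlt), pow_succ',
        Equiv.Perm.mul_apply]
  refine ⟨Q, fun x => ?_, ⟨k, hk0, le_rfl, hk⟩, ?_, ?_⟩
  · refine ⟨fun hx => ?_, fun hx => hfwd hx⟩
    have := Equiv.Perm.perm_symm_mapsTo_of_mapsTo _ hfwd hx
    rwa [Equiv.symm_apply_apply] at this
  · rintro ⟨i, hi, hik, hia⟩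
    exact hnea i hi hik hia
  · rintro _ ⟨i, -, -, rfl⟩
    exact ⟨i, by simp⟩

/-- The smallest set containing `d₀` that is invariant under `α` and `φ`. -/
def dartComponent {D : Type*} (α : D → D) (φ : Equiv.Perm D) (d₀ : D) : Set D :=
  {d | ∀ P : Set D, (∀ x, α x ∈ P ↔ x ∈ P) → (∀ x, φ x ∈ P ↔ x ∈ P) → d₀ ∈ P → d ∈ P}

section dartComponent

variable {D : Type*} (α : D → D) (φ : Equiv.Perm D) (d₀ : D)

theorem self_mem_dartComponent : d₀ ∈ dartComponent α φ d₀ := fun _ _ _ h => h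

theorem map_mem_dartComponent (x : D) :
    α x ∈ dartComponent α φ d₀ ↔ x ∈ dartComponent α φ d₀ :=
  ⟨fun h P h1 h2 h0 => (h1 x).1 (h P h1 h2 h0), fun h P h1 h2 h0 => (h1 x).2 (h P h1 h2 h0)⟩

theorem perm_mem_dartComponent (x : D) :
    φ x ∈ dartComponent α φ d₀ ↔ x ∈ dartComponent α φ d₀ :=
  ⟨fun h P h1 h2 h0 => (h2 x).1 (h P h1 h2 h0), fun h P h1 h2 h0 => (h2 x).2 (h P h1 h2 h0)⟩

theorem eq_of_invariant_on_dartComponent {β : Type*} (k : dartComponent α φ d₀ → β)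
    (h1 : ∀ d : dartComponent α φ d₀, k ⟨α d, (map_mem_dartComponent α φ d₀ d).2 d.2⟩ = k d)
    (h2 : ∀ d : dartComponent α φ d₀, k ⟨φ d, (perm_mem_dartComponent α φ d₀ d).2 d.2⟩ = k d)
    (a b : dartComponent α φ d₀) : k a = k b := by
  have key : ∀ d : dartComponent α φ d₀, k d = k ⟨d₀, self_mem_dartComponent α φ d₀⟩ := by
    intro d
    obtain ⟨_, hd⟩ := d.2
      {x | ∃ h : x ∈ dartComponent α φ d₀, k ⟨x, h⟩ = k ⟨d₀, self_mem_dartComponent α φ d₀⟩}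
      (fun x => ⟨fun ⟨h, e⟩ => ⟨(map_mem_dartComponent α φ d₀ x).1 h, by rw [← e, ← h1]⟩,
        fun ⟨h, e⟩ => ⟨(map_mem_dartComponent α φ d₀ x).2 h, by rw [← e, ← h1 ⟨x, h⟩]⟩⟩)
      (fun x => ⟨fun ⟨h, e⟩ => ⟨(perm_mem_dartComponent α φ d₀ x).1 h, by rw [← e, ← h2]⟩,
        fun ⟨h, e⟩ => ⟨(perm_mem_dartComponent α φ d₀ x).2 h, by rw [← e, ← h2 ⟨x, h⟩]⟩⟩)
      ⟨self_mem_dartComponent α φ d₀, rfl⟩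
    exact hd
  rw [key a, key b]

end dartComponent

theorem SimpleGraph.natCard_dart {V : Type*} [Finite V] (G : SimpleGraph V) :
    Nat.card G.Dart = 2 * Nat.card G.edgeSet := by
  classical
  have := Fintype.ofFinite V
  rw [Nat.card_eq_fintype_card, G.dart_card_eq_twice_card_edges, Nat.card_eq_fintype_card,
    SimpleGraph.edgeFinset_card]

instance SimpleGraph.finite_dart {V : Type*} [Finite V] (G : SimpleGraph V) : Finite G.Dart :=
  Finite.of_injective _ SimpleGraph.Dart.toProd_injective

namespace PlaneEmb

variable {V : Type u} {G : SimpleGraph V} (E : PlaneEmb G)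

/-- The face permutation, sending a dart to the next dart on the contour of its face. -/
def facePerm : Equiv.Perm G.Dart := E.rot * dartSymmPerm G

theorem facePerm_apply (d : G.Dart) : E.facePerm d = E.rot d.symm := rfl

theorem fst_facePerm (d : G.Dart) : (E.facePerm d).fst = d.snd := E.rot_fst d.symm

theorem dartFace_eq_iff {a b : G.Dart} :
    E.dartFace a = E.dartFace b ↔ E.facePerm.SameCycle a b := Quotient.eq

theorem dartFace_facePerm (d : G.Dart) : E.dartFace (E.facePerm d) = E.dartFace d :=
  E.dartFace_eq_iff.2 (Equiv.Perm.sameCycle_apply_left.2 (Equiv.Perm.SameCycle.refl _ d))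

theorem dartFace_surjective : Function.Surjective E.dartFace := Quotient.mk_surjective

theorem finite_face [Finite V] : Finite E.Face := Finite.of_surjective _ E.dartFace_surjective

/-- A set containing a dart and invariant under the rotation and reversal contains all darts. -/
theorem mem_of_invariant {P : Set G.Dart} (h1 : ∀ x, x.symm ∈ P ↔ x ∈ P)
    (h2 : ∀ x, E.facePerm x ∈ P ↔ x ∈ P) {d₀ : G.Dart} (h0 : d₀ ∈ P) (d : G.Dart) : d ∈ P := by
  have hrot : ∀ n x, (E.rot ^ n) x ∈ P ↔ x ∈ P := by
    intro n
    induction n with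
    | zero => intro x; rfl
    | succ n ih =>
      intro x
      rw [pow_succ, Equiv.Perm.mul_apply, ih, ← h1 x, ← h2 x.symm, facePerm_apply,
        SimpleGraph.Dart.symm_symm]
  have hvx : ∀ a b : G.Dart, a.fst = b.fst → a ∈ P → b ∈ P := by
    intro a b hab ha
    obtain ⟨n, rfl⟩ := E.rot_vertex a b hab
    exact (hrot n a).2 ha
  obtain ⟨w⟩ := E.connected.preconnected d₀.fst d.fst
  have hw : ∀ (u v : V) (_ : G.Walk u v), (∀ a : G.Dart, a.fst = u → a ∈ P) →
      ∀ a : G.Dart, a.fst = v → a ∈ P := by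
    intro u v p
    induction p with
    | nil => exact fun h => h
    | @cons u v w huv p ih =>
      intro hu
      refine ih fun a ha => ?_
      have := (h1 ⟨(u, v), huv⟩).2 (hu ⟨(u, v), huv⟩ rfl)
      exact hvx _ a ha.symm this
  exact hw _ _ w (fun a ha => hvx d₀ a ha.symm h0) d rfl

theorem fst_facePerm_mul_swap [DecidableEq G.Dart] {d₁ d₂ : G.Dart} (hsnd : d₁.snd = d₂.snd)
    (x : G.Dart) : ((E.facePerm * Equiv.swap d₁ d₂) x).fst = x.snd := by
  rw [Equiv.Perm.mul_apply, E.fst_facePerm, Equiv.swap_apply_def]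
  split_ifs with h1 h2
  · rw [h1, hsnd]
  · rw [h2, hsnd]
  · rfl

theorem dartFace_facePerm_mul_swap [DecidableEq G.Dart] {d₁ d₂ : G.Dart}
    (hface : E.dartFace d₁ = E.dartFace d₂) (x : G.Dart) :
    E.dartFace ((E.facePerm * Equiv.swap d₁ d₂) x) = E.dartFace x := by
  rw [Equiv.Perm.mul_apply, E.dartFace_facePerm, Equiv.swap_apply_def]
  split_ifs with h1 h2
  · rw [h1, hface]
  · rw [h2, hface]
  · rfl

/-- Cutting a plane graph along a closed curve through a vertex and a face disconnects it. -/
theorem dartComponent_mul_swap_ne_univ [Finite V] [Nontrivial V] [DecidableEq G.Dart]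
    {d₁ d₂ : G.Dart} (hne : d₁ ≠ d₂) (hface : E.dartFace d₁ = E.dartFace d₂)
    (hsnd : d₁.snd = d₂.snd) (d₀ : G.Dart) :
    ∃ d, d ∉ dartComponent SimpleGraph.Dart.symm (E.facePerm * Equiv.swap d₁ d₂) d₀ := by
  classical
  by_contra! hall
  have := E.finite_face
  obtain ⟨R, hR, hR2, hR1, hRF⟩ :=
    exists_invariant_set_mul_swap E.facePerm hne (E.dartFace_eq_iff.1 hface)
  have hne' : d₁.symm ≠ d₂.symm := fun h => hne (SimpleGraph.Dart.symm_involutive.injective h)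
  obtain ⟨Q, hQ, hQ2, hQ1, hQv⟩ :=
    exists_invariant_set_mul_swap E.rot hne'
      (by obtain ⟨n, hn⟩ := E.rot_vertex d₁.symm d₂.symm hsnd; exact ⟨n, by simpa using hn⟩)
  have hQv' : ∀ x ∈ Q, x.fst = d₁.snd := by
    intro x hx
    obtain ⟨n, -, rfl⟩ := (hQv x hx).exists_pow_eq'
    have : ∀ (n : ℕ) (y : G.Dart), ((E.rot ^ n) y).fst = y.fst := by
      intro n
      induction n with
      | zero => intro y; rfl
      | succ n ih => intro y; rw [pow_succ, Equiv.Perm.mul_apply, ih, E.rot_fst]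
    exact this _ _
  have hRF' : ∀ x ∈ R, E.dartFace x = E.dartFace d₁ := fun x hx =>
    (E.dartFace_eq_iff.2 (hRF x hx)).symm
  have hswap : ∀ x : G.Dart, (E.facePerm * Equiv.swap d₁ d₂) x =
      (E.rot * Equiv.swap d₁.symm d₂.symm) x.symm := by
    intro x
    rw [Equiv.Perm.mul_apply, Equiv.Perm.mul_apply, facePerm_apply]
    congr 1
    exact SimpleGraph.Dart.symm_involutive.injective.map_swap d₁ d₂ x
  let t : G.Dart → Option V := fun d => if d ∈ Q then none else some d.fst
  let f : G.Dart → Option E.Face := fun d => if d ∈ R then none else some (E.dartFace d)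
  have key := card_add_card_le_of_dart_maps SimpleGraph.Dart.symm
    SimpleGraph.Dart.symm_involutive SimpleGraph.Dart.symm_ne
    (E.facePerm * Equiv.swap d₁ d₂) t f ?_ ?_ ?_ ?_ ?_
  · have e1 := E.euler
    have e2 := G.natCard_dart
    rw [Finite.card_option, Finite.card_option] at key
    change Nat.card V + Nat.card E.Face = _ at e1
    omega
  · rintro (_ | v)
    · exact ⟨_, if_pos hQ2⟩
    · by_cases hv : v = d₁.snd
      · exact ⟨d₁.symm, by simp only [t, if_neg hQ1, hv]; rfl⟩
      · obtain ⟨w, hw⟩ := E.connected.preconnected.exists_adj_of_nontrivial v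
        exact ⟨⟨(v, w), hw⟩, if_neg fun h => hv (hQv' _ h)⟩
  · rintro (_ | F)
    · exact ⟨_, if_pos hR2⟩
    · by_cases hF : F = E.dartFace d₁
      · exact ⟨d₁, by simp only [f, if_neg hR1, hF]⟩
      · obtain ⟨d, rfl⟩ := E.dartFace_surjective F
        exact ⟨d, if_neg fun h => hF (hRF' _ h)⟩
  · intro d
    have : (E.facePerm * Equiv.swap d₁ d₂) d ∈ Q ↔ d.symm ∈ Q := by rw [hswap, hQ]
    simp only [t, this, E.fst_facePerm_mul_swap hsnd]
    rfl
  · intro d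
    simp only [f, hR, E.dartFace_facePerm_mul_swap hface]
  · intro k h1 h2 a b
    exact eq_of_invariant_on_dartComponent _ _ d₀ (fun x => k x.1) (fun x => h1 x.1)
      (fun x => h2 x.1) ⟨a, hall a⟩ ⟨b, hall b⟩

end PlaneEmb

namespace PlaneEmb

variable {V : Type u} {G : SimpleGraph V} (E : PlaneEmb G)

/-- A set of darts that is cut off by a closed curve through a bounded face and one of its
vertices, and lies on the side of the unbounded face, violates the generalized Laman property. -/
theorem not_genLaman_of_dartComponent [Finite V] [DecidableEq G.Dart] {big : G.Dart → Prop}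
    (hcpt : IsCPTLabelling E big) {d₁ d₂ d₀ : G.Dart} (hface : E.dartFace d₁ = E.dartFace d₂)
    (hsnd : d₁.snd = d₂.snd) (hbdd : E.dartFace d₂ ≠ E.outer) (h₀ : E.dartFace d₀ = E.outer)
    (h₁ : d₁ ∈ dartComponent SimpleGraph.Dart.symm (E.facePerm * Equiv.swap d₁ d₂) d₀)
    (h₂ : d₂ ∉ dartComponent SimpleGraph.Dart.symm (E.facePerm * Equiv.swap d₁ d₂) d₀) :
    ¬ GenLaman G big := by
  classical
  intro hgl
  have := E.finite_face
  have := Fintype.ofFinite V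
  have := Fintype.ofFinite E.Face
  let φ := E.facePerm * Equiv.swap d₁ d₂
  let B := dartComponent SimpleGraph.Dart.symm φ d₀
  have hBα : ∀ x : G.Dart, x.symm ∈ B ↔ x ∈ B := map_mem_dartComponent _ φ d₀
  have hBφ : ∀ x : G.Dart, φ x ∈ B ↔ x ∈ B := perm_mem_dartComponent _ φ d₀
  have h0B : d₀ ∈ B := self_mem_dartComponent _ φ d₀
  let S : Set V := (fun d : G.Dart => d.fst) '' B
  let Y : Set E.Face := E.dartFace '' B
  have hfstS : ∀ d ∈ B, d.fst ∈ S := fun d hd => ⟨d, hd, rfl⟩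
  have hsndS : ∀ d ∈ B, d.snd ∈ S := fun d hd => ⟨d.symm, (hBα d).2 hd, rfl⟩
  have heuler : 2 * (Nat.card S + Nat.card Y) ≤ Nat.card B + 4 := by
    refine card_add_card_le_of_dart_maps (fun d : B => (⟨d.1.symm, (hBα d).2 d.2⟩ : B))
      (fun d => Subtype.ext d.1.symm_symm) (fun d h => d.1.symm_ne (congrArg Subtype.val h))
      (φ.subtypePerm hBφ) (fun d => (⟨d.1.fst, hfstS d d.2⟩ : S))
      (fun d => (⟨E.dartFace d, d, d.2, rfl⟩ : Y)) ?_ ?_ ?_ ?_ ?_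
    · rintro ⟨_, d, hd, rfl⟩
      exact ⟨⟨d, hd⟩, rfl⟩
    · rintro ⟨_, d, hd, rfl⟩
      exact ⟨⟨d, hd⟩, rfl⟩
    · exact fun d => Subtype.ext (E.fst_facePerm_mul_swap hsnd d.1)
    · exact fun d => Subtype.ext (E.dartFace_facePerm_mul_swap hface d.1)
    · exact fun k h1 h2 => eq_of_invariant_on_dartComponent _ φ d₀ k h1 h2
  have hS2 : 2 ≤ Nat.card S := by
    rw [Nat.card_coe_set_eq]
    exact (Set.one_lt_ncard (Set.toFinite S)).2
      ⟨_, hfstS d₀ h0B, _, hsndS d₀ h0B, d₀.fst_ne_snd⟩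
  have hlaman := hgl S hS2
  have hsplit : Nat.card {v ∈ S | PointedVx big v} + Nat.card {v ∈ S | ¬ PointedVx big v} =
      Nat.card S := by
    simp only [Nat.card_coe_set_eq]
    exact Set.ncard_inter_add_ncard_sdiff_eq_ncard S {v | PointedVx big v} (Set.toFinite _)
  have hedges : Nat.card B ≤ 2 * Nat.card (G.induce S).edgeSet := by
    rw [← SimpleGraph.natCard_dart]
    refine Nat.card_le_card_of_injective (fun d : B => (⟨(⟨d.1.fst, hfstS d d.2⟩,
      ⟨d.1.snd, hsndS d d.2⟩), d.1.adj⟩ : (G.induce S).Dart)) ?_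
    intro a b hab
    have := congrArg SimpleGraph.Dart.toProd hab
    simp only [Prod.mk.injEq, Subtype.mk.injEq] at this
    exact Subtype.ext (SimpleGraph.Dart.ext _ _ (Prod.ext this.1 this.2))
  let T : Finset G.Dart := insert d₂ B.toFinset
  have hT : T.card = Nat.card B + 1 := by
    rw [Finset.card_insert_of_notMem (by simpa using h₂), Set.toFinset_card,
      Nat.card_eq_fintype_card]
  have hTB : ∀ d ∈ T, d = d₂ ∨ d ∈ B := by
    intro d hd
    simpa [T] using hd
  have hsmall : (T.filter fun d => ¬ big d.symm).card ≤ 3 * (Y.toFinset.erase E.outer).card := by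
    refine Finset.card_le_mul_card_image_of_maps_to (f := E.dartFace) ?_ 3 ?_
    · intro d hd
      rw [Finset.mem_filter] at hd
      refine Finset.mem_erase.2 ⟨fun h => hd.2 (hcpt.outer_big _ ?_), ?_⟩
      · rw [angleFace, SimpleGraph.Dart.symm_symm, h]
      · rw [Set.mem_toFinset]
        rcases hTB d hd.1 with rfl | h
        · exact ⟨d₁, h₁, hface⟩
        · exact ⟨d, h, rfl⟩
    · intro F hF
      rw [← hcpt.bounded_small F (Finset.ne_of_mem_erase hF), Nat.card_coe_set_eq,
        ← Set.ncard_coe_finset]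
      refine Set.ncard_le_ncard_of_injOn SimpleGraph.Dart.symm ?_
        SimpleGraph.Dart.symm_involutive.injective.injOn (Set.toFinite _)
      intro d hd
      simp only [Finset.coe_filter, Finset.mem_filter, Set.mem_ofPred_eq] at hd
      exact ⟨by rw [angleFace, SimpleGraph.Dart.symm_symm, hd.2], hd.1.2⟩
  have hbig : (T.filter fun d => big d.symm).card ≤ Nat.card {v ∈ S | PointedVx big v} := by
    rw [Nat.card_coe_set_eq, ← Set.ncard_coe_finset]
    refine Set.ncard_le_ncard_of_injOn (fun d : G.Dart => d.snd) ?_ ?_ (Set.toFinite _)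
    · intro d hd
      simp only [Finset.coe_filter, Set.mem_ofPred_eq] at hd
      refine ⟨?_, d.symm, hd.2, rfl⟩
      rcases hTB d hd.1 with rfl | h
      · exact hsnd ▸ hsndS d₁ h₁
      · exact hsndS d h
    · intro a ha b hb hab
      simp only [Finset.coe_filter, Set.mem_ofPred_eq] at ha hb
      exact SimpleGraph.Dart.symm_involutive.injective (hcpt.one_big _ _ ha.2 hb.2 hab)
  have hY : (Y.toFinset.erase E.outer).card + 1 = Nat.card Y := by
    have hmem : E.outer ∈ Y := ⟨d₀, h0B, h₀⟩
    rw [Finset.card_erase_add_one (Set.mem_toFinset.2 hmem), Set.toFinset_card,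
      Nat.card_eq_fintype_card]
  have hTsplit := T.card_filter_add_card_filter_not (fun d => big d.symm)
  omega

/-- No vertex appears twice on the contour of a face. -/
theorem eq_of_dartFace_eq_of_snd_eq [Finite V] [Nontrivial V] {big : G.Dart → Prop}
    (hcpt : IsCPTLabelling E big) (hgl : GenLaman G big) {d₁ d₂ : G.Dart}
    (hface : E.dartFace d₁ = E.dartFace d₂) (hsnd : d₁.snd = d₂.snd) : d₁ = d₂ := by
  classical
  by_contra hne
  by_cases hout : E.dartFace d₂ = E.outer
  · refine hne (SimpleGraph.Dart.symm_involutive.injective (hcpt.one_big _ _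
      (hcpt.outer_big _ ?_) (hcpt.outer_big _ ?_) hsnd))
    · rw [angleFace, SimpleGraph.Dart.symm_symm, hface, hout]
    · rw [angleFace, SimpleGraph.Dart.symm_symm, hout]
  obtain ⟨d₀, h₀⟩ := E.dartFace_surjective E.outer
  obtain ⟨d, hd⟩ := E.dartComponent_mul_swap_ne_univ hne hface hsnd d₀
  let φ := E.facePerm * Equiv.swap d₁ d₂
  let B := dartComponent SimpleGraph.Dart.symm φ d₀
  have hnot : ¬ (d₁ ∈ B ↔ d₂ ∈ B) := by
    intro hiff
    refine hd (E.mem_of_invariant (P := B) (map_mem_dartComponent _ φ d₀) (fun x => ?_)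
      (self_mem_dartComponent _ φ d₀) d)
    have : E.facePerm x = φ (Equiv.swap d₁ d₂ x) := by
      simp only [φ, Equiv.Perm.mul_apply, Equiv.swap_apply_self]
    rw [this, perm_mem_dartComponent, Equiv.swap_apply_def]
    split_ifs with h1 h2
    · rw [h1]; exact hiff.symm
    · rw [h2]; exact hiff
    · rfl
  by_cases h₁ : d₁ ∈ B
  · exact E.not_genLaman_of_dartComponent hcpt hface hsnd hout h₀ h₁
      (fun h₂ => hnot (iff_of_true h₁ h₂)) hgl
  · have h₂ : d₂ ∈ B := by
      by_contra h₂
      exact hnot (iff_of_false h₁ h₂)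
    refine E.not_genLaman_of_dartComponent (d₁ := d₂) (d₂ := d₁) hcpt hface.symm hsnd.symm
      (hface ▸ hout) h₀ ?_ ?_ hgl
    · rwa [Equiv.swap_comm]
    · rwa [Equiv.swap_comm]

/-- If no vertex appears twice on the contour of a face, then neither does an edge. -/
theorem dartFace_symm_ne (hV : 3 ≤ Nat.card V)
    (hinj : ∀ d₁ d₂ : G.Dart, E.dartFace d₁ = E.dartFace d₂ → d₁.snd = d₂.snd → d₁ = d₂)
    (d : G.Dart) : E.dartFace d.symm ≠ E.dartFace d := by
  have key : ∀ d : G.Dart, E.dartFace d.symm = E.dartFace d → E.facePerm d = d.symm := by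
    intro d hd
    have h := E.dartFace_facePerm (E.facePerm.symm d.symm)
    have h' := E.fst_facePerm (E.facePerm.symm d.symm)
    rw [Equiv.apply_symm_apply] at h h'
    rw [hinj d (E.facePerm.symm d.symm) (by rw [← h, hd]) h', Equiv.apply_symm_apply,
      ← hinj d (E.facePerm.symm d.symm) (by rw [← h, hd]) h']
  intro hd
  have h1 := key d hd
  have h2 := key d.symm (by rw [SimpleGraph.Dart.symm_symm, hd])
  rw [SimpleGraph.Dart.symm_symm] at h2
  have hall : ∀ x, x ∈ ({d, d.symm} : Set G.Dart) := by
    refine E.mem_of_invariant (d₀ := d) (fun x => ?_) (fun x => ?_) (by simp)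
    · simp only [Set.mem_insert_iff, Set.mem_singleton_iff]
      rw [SimpleGraph.Dart.symm_involutive.injective.eq_iff, or_comm,
        SimpleGraph.Dart.symm_involutive.eq_iff]
    · simp only [Set.mem_insert_iff, Set.mem_singleton_iff]
      nth_rw 1 [← h2]
      rw [← h1, E.facePerm.injective.eq_iff, E.facePerm.injective.eq_iff, h1, or_comm]
  have hfin : Finite V := Nat.finite_of_card_ne_zero (by omega)
  have : Nontrivial V := Finite.one_lt_card_iff_nontrivial.1 (by omega)
  have hsub : (Set.univ : Set V) ⊆ {d.fst, d.snd} := by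
    intro v _
    obtain ⟨w, hw⟩ := E.connected.preconnected.exists_adj_of_nontrivial v
    rcases hall ⟨(v, w), hw⟩ with h | h
    · exact Or.inl (congrArg (fun d : G.Dart => d.fst) h)
    · exact Or.inr (congrArg (fun d : G.Dart => d.fst) h)
  have hle := Set.ncard_le_ncard hsub (Set.toFinite _)
  rw [Set.ncard_univ] at hle
  rw [Set.ncard_pair d.fst_ne_snd] at hle
  omega

/-- The walk along the first `n` darts of the contour starting at `d`. -/
def contourWalk : (n : ℕ) → (d : G.Dart) → G.Walk d.fst ((E.facePerm ^ n) d).fst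
  | 0, d => .nil
  | n + 1, d => .cons d.adj ((contourWalk n (E.facePerm d)).copy (E.fst_facePerm d)
      (by rw [pow_succ, Equiv.Perm.mul_apply]))

theorem edges_contourWalk (n : ℕ) (d : G.Dart) : (E.contourWalk n d).edges =
    (List.range n).map fun i => ((E.facePerm ^ i) d).edge := by
  induction n generalizing d with
  | zero => rfl
  | succ n ih =>
    rw [contourWalk, SimpleGraph.Walk.edges_cons, SimpleGraph.Walk.edges_copy, ih,
      List.range_succ_eq_map, List.map_cons, List.map_map]
    rfl

theorem support_tail_contourWalk (n : ℕ) (d : G.Dart) : (E.contourWalk n d).support.tail =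
    (List.range n).map fun i => ((E.facePerm ^ i) d).snd := by
  induction n generalizing d with
  | zero => rfl
  | succ n ih =>
    rw [contourWalk, SimpleGraph.Walk.support_cons, SimpleGraph.Walk.support_copy,
      List.tail_cons, ← SimpleGraph.Walk.cons_tail_support, ih, E.fst_facePerm,
      List.range_succ_eq_map, List.map_cons, List.map_map]
    rfl

end PlaneEmb

theorem PlaneEmb.exists_isCycle_contour {V : Type u} [Finite V] {G : SimpleGraph V}
    (E : PlaneEmb G)
    (hinj : ∀ d₁ d₂ : G.Dart, E.dartFace d₁ = E.dartFace d₂ → d₁.snd = d₂.snd → d₁ = d₂)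
    (hsymm : ∀ d : G.Dart, E.dartFace d.symm ≠ E.dartFace d) (F : E.Face) :
    ∃ (v : V) (c : G.Walk v v), c.IsCycle ∧
      ∀ e : Sym2 V, e ∈ c.edges ↔ ∃ d : G.Dart, E.dartFace d = F ∧ d.edge = e := by
  obtain ⟨d, rfl⟩ := E.dartFace_surjective F
  let n := Function.minimalPeriod E.facePerm d
  have hn : 0 < n := Function.minimalPeriod_pos_of_mem_periodicPts
    (E.facePerm.injective.mem_periodicPts d)
  have hd : (E.facePerm ^ n) d = d := by
    rw [← Equiv.Perm.iterate_eq_pow]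
    exact Function.iterate_minimalPeriod
  have hface : ∀ i, E.dartFace ((E.facePerm ^ i) d) = E.dartFace d := fun i =>
    E.dartFace_eq_iff.2 (Equiv.Perm.sameCycle_pow_left.2 (Equiv.Perm.SameCycle.refl _ d))
  have hpow : ∀ i < n, ∀ j < n, (E.facePerm ^ i) d = (E.facePerm ^ j) d → i = j := by
    intro i hi j hj hij
    rw [← Equiv.Perm.iterate_eq_pow, ← Equiv.Perm.iterate_eq_pow] at hij
    exact Function.iterate_injOn_Iio_minimalPeriod hi hj hij
  refine ⟨d.fst, (E.contourWalk n d).copy rfl (by rw [hd]), ?_, fun e => ?_⟩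
  · rw [SimpleGraph.Walk.isCycle_def, SimpleGraph.Walk.isTrail_def,
      SimpleGraph.Walk.edges_copy, SimpleGraph.Walk.support_copy, E.edges_contourWalk,
      E.support_tail_contourWalk]
    refine ⟨?_, fun h => ?_, ?_⟩
    · refine List.Nodup.map_on (fun i hi j hj hij => ?_) List.nodup_range
      rw [List.mem_range] at hi hj
      rcases (SimpleGraph.dart_edge_eq_iff _ _).1 hij with h | h
      · exact hpow i hi j hj h
      · refine absurd ?_ (hsymm ((E.facePerm ^ j) d))
        rw [← h, hface, hface]
    · have h' := congrArg SimpleGraph.Walk.edges h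
      rw [SimpleGraph.Walk.edges_copy, E.edges_contourWalk, SimpleGraph.Walk.edges_nil,
        List.map_eq_nil_iff, List.range_eq_nil] at h'
      omega
    · refine List.Nodup.map_on (fun i hi j hj hij => ?_) List.nodup_range
      rw [List.mem_range] at hi hj
      exact hpow i hi j hj (hinj _ _ (by rw [hface, hface]) hij)
  · rw [SimpleGraph.Walk.edges_copy, E.edges_contourWalk]
    simp only [List.mem_map, List.mem_range]
    constructor
    · rintro ⟨i, -, rfl⟩
      exact ⟨_, hface i, rfl⟩
    · rintro ⟨x, hx, rfl⟩
      obtain ⟨i, -, rfl⟩ := (E.dartFace_eq_iff.1 hx.symm).exists_pow_eq'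
      refine ⟨i % n, Nat.mod_lt _ hn, ?_⟩
      rw [← Equiv.Perm.iterate_eq_pow, ← Equiv.Perm.iterate_eq_pow,
        Function.iterate_mod_minimalPeriod_eq]

/-- In a combinatorial pseudo-triangulation on at least three vertices with the generalized Laman
property, all faces are non-degenerate: the edges incident to every face form a simple closed
cycle, and no edge appears twice in the contour cycle of a face. -/
theorem genLaman_cpt_nondegenerate_faces
    {V : Type u} [Finite V] (G : SimpleGraph V) (hV : 3 ≤ Nat.card V)
    (E : PlaneEmb G) (big : G.Dart → Prop) (hcpt : IsCPTLabelling E big)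
    (hgl : GenLaman G big) :
    NonDegenerateFaces E := by
  have : Nontrivial V := Finite.one_lt_card_iff_nontrivial.1 (by omega)
  have hinj : ∀ d₁ d₂ : G.Dart, E.dartFace d₁ = E.dartFace d₂ → d₁.snd = d₂.snd → d₁ = d₂ :=
    fun _ _ => E.eq_of_dartFace_eq_of_snd_eq hcpt hgl
  have hsymm := E.dartFace_symm_ne hV hinj
  exact fun F => ⟨E.exists_isCycle_contour hinj hsymm F, fun d hd => hd ▸ hsymm d⟩
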